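/- (Hua's lemma) Let k ≥ 1 be a fixed integer. There exist constants c = c(k) ≥ 0 and C = C(k) > 0 such that for every integer N ≥ 2, ∫₀¹ |g(α)|^{2^k} dα ≤ C·N^{2^k − k}·(log N)^c, where g(α) = ∑_{1 ≤ x ≤ N} e(α·x^k). -/

import Mathlib

/-- `e(α) = exp(2πiα)`. -/
noncomputable def eAdd (α : ℝ) : ℂ := Complex.exp (2 * Real.pi * Complex.I * α)

/-- The Weyl sum `g(α) = ∑_{1 ≤ x ≤ N} e(α x^k)`. -/
noncomputable def weylSum (k N : ℕ) (α : ℝ) : ℂ :=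
  ∑ x ∈ Finset.Icc 1 N, eAdd (α * (x : ℝ) ^ k)

lemma card_divisors_mul_le (m n : ℕ) :
    (m * n).divisors.card ≤ m.divisors.card * n.divisors.card := by
  rw [Nat.divisors_mul]
  exact Finset.card_mul_le

lemma card_divisors_pow_le (m n : ℕ) : (m ^ n).divisors.card ≤ m.divisors.card ^ n := by
  induction n with
  | zero => simp
  | succ n ih =>
    rw [pow_succ, pow_succ]
    exact (card_divisors_mul_le _ _).trans (Nat.mul_le_mul_right _ ih)

lemma card_divisors_mono {m n : ℕ} (hn : n ≠ 0) (h : m ∣ n) :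
    m.divisors.card ≤ n.divisors.card :=
  Finset.card_le_card (Nat.divisors_subset_of_dvd hn h)

lemma card_divisors_le_two_pow {y : ℕ} (B n : ℕ) (hn : n < y ^ B)
    (hp : ∀ p, p.Prime → p ∣ n → y ≤ p) : n.divisors.card ≤ 2 ^ B := by
  induction B generalizing n with
  | zero =>
    obtain rfl : n = 0 := by simpa using hn
    simp
  | succ B ih =>
    by_cases h1 : n = 1
    · subst h1; simpa using Nat.one_le_two_pow
    have hpp := Nat.minFac_prime h1
    obtain ⟨m, hm⟩ := Nat.minFac_dvd n
    have hy := hp _ hpp (Nat.minFac_dvd n)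
    have hmy : m < y ^ B := by
      by_contra! hc
      have := Nat.mul_le_mul hy hc
      rw [← hm, ← pow_succ'] at this
      omega
    have h2 := ih m hmy fun p hpr hd => hp p hpr (hm ▸ hd.mul_left _)
    calc n.divisors.card = (n.minFac * m).divisors.card := by rw [← hm]
      _ ≤ n.minFac.divisors.card * m.divisors.card := card_divisors_mul_le _ _
      _ ≤ 2 * 2 ^ B := by
        gcongr
        rw [hpp.divisors]
        exact Finset.card_le_two
      _ = 2 ^ (B + 1) := by ring

/-- The number of divisors of `n` is controlled by that of a small divisor of `n`. -/
lemma exists_small_divisor {y N : ℕ} (hy : 1 ≤ y) (hN : y * y ≤ N) (B n : ℕ) (hn0 : n ≠ 0)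
    (hn : n < y ^ B) :
    ∃ δ, δ ∣ n ∧ δ ≤ N ∧ n.divisors.card ≤ 2 ^ B * δ.divisors.card ^ B := by
  induction B generalizing n with
  | zero => simp at hn; omega
  | succ B ih =>
    by_cases hd : ∃ δ, δ ∣ n ∧ y ≤ δ ∧ δ ≤ N
    · obtain ⟨δ, ⟨m, rfl⟩, hyδ, hδN⟩ := hd
      have hm : m < y ^ B := by
        by_contra! hc
        have := Nat.mul_le_mul hyδ hc
        rw [← pow_succ'] at this
        omega
      obtain ⟨δ', hδ', hδ'N, hc⟩ := ih m (right_ne_zero_of_mul hn0) hm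
      have key : ∀ M, δ.divisors.card ≤ M → δ'.divisors.card ≤ M →
          (δ * m).divisors.card ≤ 2 ^ (B + 1) * M ^ (B + 1) := fun M h1 h2 =>
        calc (δ * m).divisors.card ≤ δ.divisors.card * m.divisors.card :=
              card_divisors_mul_le _ _
          _ ≤ M * (2 ^ B * M ^ B) := by
            gcongr
            exact hc.trans (by gcongr)
          _ = 2 ^ B * M ^ (B + 1) := by ring
          _ ≤ 2 ^ (B + 1) * M ^ (B + 1) := by gcongr <;> omega
      rcases le_total δ.divisors.card δ'.divisors.card with h | h
      · exact ⟨δ', hδ'.mul_left _, hδ'N, key _ h le_rfl⟩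
      · exact ⟨δ, dvd_mul_right _ _, hδN, key _ le_rfl h⟩
    · push Not at hd
      have hne : (n.divisors.filter (· ≤ N)).Nonempty :=
        ⟨1, by simp [hn0]; nlinarith⟩
      obtain ⟨δ, hδ, hmax⟩ := Finset.exists_max_image _ id hne
      simp only [Finset.mem_filter, Nat.mem_divisors, id] at hδ hmax
      obtain ⟨⟨⟨m, rfl⟩, -⟩, hδN⟩ := hδ
      have hδ0 := left_ne_zero_of_mul hn0
      refine ⟨δ, dvd_mul_right _ _, hδN, ?_⟩
      have hδy : δ < y := by
        by_contra! hc
        exact absurd (hd δ (dvd_mul_right _ _) hc) (by omega)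
      have h2 : m.divisors.card ≤ 2 ^ (B + 1) := by
        refine card_divisors_le_two_pow _ _ (lt_of_le_of_lt ?_ hn) fun p hp hpm => ?_
        · exact Nat.le_mul_of_pos_left _ (by omega)
        · by_contra! hc
          have h3 : δ * p ≤ N := (Nat.mul_le_mul hδy.le hc.le).trans hN
          have h4 := hmax (δ * p) ⟨⟨mul_dvd_mul_left _ hpm, hn0⟩, h3⟩
          nlinarith [hp.two_le, Nat.pos_of_ne_zero hδ0]
      calc (δ * m).divisors.card ≤ δ.divisors.card * m.divisors.card :=
            card_divisors_mul_le _ _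
        _ ≤ δ.divisors.card ^ (B + 1) * 2 ^ (B + 1) := by
          gcongr
          exact Nat.le_self_pow (by omega) _
        _ = _ := by ring

lemma sum_inv_le (N : ℕ) : ∑ q ∈ Finset.Icc 1 N, (1 : ℝ) / q ≤ 1 + Real.log N := by
  have := harmonic_le_one_add_log N
  rw [harmonic_eq_sum_Icc] at this
  simpa using this

/-- Moments of the divisor function with logarithmic weight. -/
lemma sum_card_divisors_pow_div_le (N m : ℕ) :
    ∑ q ∈ Finset.Icc 1 N, (q.divisors.card : ℝ) ^ m / q ≤ (1 + Real.log N) ^ 2 ^ m := by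
  induction m with
  | zero => simpa using sum_inv_le N
  | succ m ih =>
    have h0 : 0 ≤ ∑ q ∈ Finset.Icc 1 N, (q.divisors.card : ℝ) ^ m / q :=
      Finset.sum_nonneg fun _ _ => by positivity
    calc ∑ q ∈ Finset.Icc 1 N, (q.divisors.card : ℝ) ^ (m + 1) / q
        ≤ ∑ q ∈ Finset.Icc 1 N, ∑ u ∈ q.divisorsAntidiagonal,
            ((u.1.divisors.card : ℝ) ^ m / u.1) * ((u.2.divisors.card : ℝ) ^ m / u.2) := by
          refine Finset.sum_le_sum fun q hq => ?_
          have hq0 : q ≠ 0 := by simp at hq; omega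
          have h1 : ∀ u ∈ q.divisorsAntidiagonal, (q.divisors.card : ℝ) ^ m / q ≤
              ((u.1.divisors.card : ℝ) ^ m / u.1) * ((u.2.divisors.card : ℝ) ^ m / u.2) := by
            rintro ⟨a, b⟩ hu
            obtain ⟨rfl, -⟩ := Nat.mem_divisorsAntidiagonal.mp hu
            rw [div_mul_div_comm, ← mul_pow]
            push_cast
            gcongr
            exact_mod_cast card_divisors_mul_le a b
          have h2 := Finset.card_nsmul_le_sum _ _ _ h1
          have h3 : q.divisorsAntidiagonal.card = q.divisors.card := by
            rw [← Nat.map_div_right_divisors, Finset.card_map]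
          rw [h3, nsmul_eq_mul] at h2
          refine le_trans (le_of_eq ?_) h2
          ring
      _ = ∑ u ∈ (Finset.Icc 1 N).sigma fun q => q.divisorsAntidiagonal,
            ((u.2.1.divisors.card : ℝ) ^ m / u.2.1) * ((u.2.2.divisors.card : ℝ) ^ m / u.2.2) := by
          rw [Finset.sum_sigma]
      _ = ∑ u ∈ ((Finset.Icc 1 N).sigma fun q => q.divisorsAntidiagonal).image Sigma.snd,
            ((u.1.divisors.card : ℝ) ^ m / u.1) * ((u.2.divisors.card : ℝ) ^ m / u.2) := by
          rw [Finset.sum_image]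
          rintro ⟨q, a, b⟩ h ⟨q', a', b'⟩ h' heq
          obtain ⟨rfl, rfl⟩ := Prod.mk.inj heq
          have e := (Nat.mem_divisorsAntidiagonal.mp (Finset.mem_sigma.mp h).2).1
          have e' := (Nat.mem_divisorsAntidiagonal.mp (Finset.mem_sigma.mp h').2).1
          obtain rfl : q = q' := e.symm.trans e'
          rfl
      _ ≤ ∑ u ∈ Finset.Icc 1 N ×ˢ Finset.Icc 1 N,
            ((u.1.divisors.card : ℝ) ^ m / u.1) * ((u.2.divisors.card : ℝ) ^ m / u.2) := by
          refine Finset.sum_le_sum_of_subset_of_nonneg ?_ fun _ _ _ => by positivity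
          rintro ⟨a, b⟩ h
          obtain ⟨⟨q, c⟩, hq, rfl⟩ := Finset.mem_image.mp h
          obtain ⟨hqN, hab⟩ := Finset.mem_sigma.mp hq
          obtain ⟨h2, h3⟩ := Nat.mem_divisorsAntidiagonal.mp hab
          rw [← h2] at h3
          have ha : 0 < a := Nat.pos_of_ne_zero (left_ne_zero_of_mul h3)
          have hb : 0 < b := Nat.pos_of_ne_zero (right_ne_zero_of_mul h3)
          simp only [Finset.mem_Icc, Finset.mem_product] at hqN h2 ⊢
          refine ⟨⟨ha, ?_⟩, hb, ?_⟩ <;> nlinarith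
      _ = (∑ q ∈ Finset.Icc 1 N, (q.divisors.card : ℝ) ^ m / q) ^ 2 := by
          rw [sq, Finset.sum_mul_sum, Finset.sum_product]
      _ ≤ ((1 + Real.log N) ^ 2 ^ m) ^ 2 := by gcongr
      _ = _ := by rw [← pow_mul, ← pow_succ]

lemma pow_dvd_right_of_not_pow_dvd_left {p : ℤ} (hp : Prime p) (t m : ℕ) {x y : ℤ}
    (hx : ¬ p ^ (t + 1) ∣ x) (h : p ^ (t + m) ∣ x * y) : p ^ m ∣ y := by
  induction t generalizing x with
  | zero => exact hp.pow_dvd_of_dvd_mul_left _ (by simpa using hx) (by simpa using h)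
  | succ t ih =>
    by_cases hpx : p ∣ x
    · obtain ⟨z, rfl⟩ := hpx
      refine ih (x := z) (fun hz => hx ?_) ?_
      · rw [pow_succ']
        exact mul_dvd_mul_left p hz
      · rw [mul_assoc, add_right_comm, pow_succ'] at h
        exact (mul_dvd_mul_iff_left hp.ne_zero).mp h
    · exact (pow_dvd_pow p (by omega)).trans (hp.pow_dvd_of_dvd_mul_left _ hpx h)

open Polynomial in
/-- A monic polynomial of degree `n` cannot be highly divisible by a prime power at more than `n`
incongruent points. -/
lemma card_le_of_pow_dvd_eval {p : ℕ} (hp : p.Prime) (t : ℕ) (n : ℕ) (f : ℤ[X]) (hf : f.Monic)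
    (hdeg : f.natDegree = n) (a : ℕ) (ha : n * t < a) (S : Finset ℤ)
    (hS : ∀ x ∈ S, ∀ y ∈ S, (p : ℤ) ^ (t + 1) ∣ x - y → x = y)
    (hdvd : ∀ x ∈ S, (p : ℤ) ^ a ∣ f.eval x) : S.card ≤ n := by
  induction n generalizing f a S with
  | zero =>
    rw [Nat.le_zero, Finset.card_eq_zero, Finset.eq_empty_iff_forall_notMem]
    intro x hx
    have h := hdvd x hx
    rw [hf.natDegree_eq_zero.mp hdeg, eval_one] at h
    have h1 : (p : ℤ) ∣ 1 := (dvd_pow_self _ (by omega)).trans h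
    have := Int.natCast_dvd_natCast.mp (by simpa using h1 : (p : ℤ) ∣ ((1 : ℕ) : ℤ))
    exact hp.one_lt.ne' (Nat.dvd_one.mp this)
  | succ n ih =>
    rcases S.eq_empty_or_nonempty with rfl | ⟨x₀, hx₀⟩
    · simp
    set q := f /ₘ (X - C x₀) with hq
    have hfq : ∀ x, f.eval x = (x - x₀) * q.eval x + f.eval x₀ := fun x => by
      have h := modByMonic_add_div f (X - C x₀)
      rw [modByMonic_X_sub_C_eq_C_eval] at h
      conv_lhs => rw [← h]
      simp [hq]; ring
    have hqdeg : q.natDegree = n := by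
      rw [hq, natDegree_divByMonic _ (monic_X_sub_C _), hdeg, natDegree_X_sub_C]; rfl
    have hqm : q.Monic := by
      rw [Monic, hq, leadingCoeff_divByMonic_of_monic (monic_X_sub_C _)]
      · exact hf
      · rw [degree_X_sub_C, degree_eq_natDegree hf.ne_zero, hdeg]
        exact_mod_cast Nat.le_add_left 1 n
    have hpz : Prime (p : ℤ) := Nat.prime_iff_prime_int.mp hp
    have := ih q hqm hqdeg (a - t) (by
        have : (n + 1) * t = n * t + t := by ring
        omega) (S.erase x₀)
      (fun x hx y hy => hS x (Finset.mem_of_mem_erase hx) y (Finset.mem_of_mem_erase hy))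
      (fun x hx => by
        have hxS := Finset.mem_of_mem_erase hx
        have h1 : (p : ℤ) ^ a ∣ (x - x₀) * q.eval x := by
          have := dvd_sub (hdvd x hxS) (hdvd x₀ hx₀)
          rwa [hfq x, add_sub_cancel_right] at this
        refine pow_dvd_right_of_not_pow_dvd_left hpz t _ (fun h => ?_) (?_ : _ ∣ (x - x₀) * _)
        · exact Finset.ne_of_mem_erase hx (hS x hxS x₀ hx₀ h)
        · rwa [Nat.add_sub_cancel' (by nlinarith : t ≤ a)])
    rw [Finset.card_erase_of_mem hx₀] at this
    omega

open Polynomial in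
/-- Where a monic polynomial of degree `n` is divisible by `δ`, its argument is restricted to few
residue classes modulo some `β` with `β ∣ δ ∣ β ^ n`. -/
lemma exists_modulus {n : ℕ} (hn : 1 ≤ n) (f : ℤ[X]) (hf : f.Monic) (hdeg : f.natDegree = n)
    (δ : ℕ) (hδ : δ ≠ 0) :
    ∃ β : ℕ, β ∣ δ ∧ δ ∣ β ^ n ∧ ∀ S : Finset ℤ, (∀ x ∈ S, (δ : ℤ) ∣ f.eval x) →
      (S.image (· % (β : ℤ))).card ≤ β.divisors.card ^ n := by
  induction δ using Nat.recOnPosPrimePosCoprime with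
  | zero => exact absurd rfl hδ
  | one =>
    refine ⟨1, by simp, by simp, fun S _ => ?_⟩
    have : S.image (· % ((1 : ℕ) : ℤ)) ⊆ {0} := by
      intro x; simp; tauto
    simpa using Finset.card_le_card this
  | prime_pow p a hp ha =>
    set t := (a - 1) / n with ht
    have h1 : n * t ≤ a - 1 := Nat.mul_div_le _ _
    have h2 : a - 1 < n * (t + 1) := Nat.lt_mul_div_succ _ (by omega)
    refine ⟨p ^ (t + 1), pow_dvd_pow _ ?_, ?_, fun S hS => ?_⟩
    · have := Nat.le_mul_of_pos_left t (show 0 < n by omega)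
      omega
    · rw [← pow_mul]
      exact pow_dvd_pow _ (by rw [mul_comm]; omega)
    · obtain ⟨U, hU, hUi⟩ := Finset.exists_subset_injOn_image_eq_of_surjOn (S : Set ℤ)
        (S.image (· % ((p ^ (t + 1) : ℕ) : ℤ))) (f := (· % ((p ^ (t + 1) : ℕ) : ℤ)))
        (by simpa using Set.surjOn_image _ _)
      rw [← hUi.2, Finset.card_image_of_injOn hUi.1]
      have := card_le_of_pow_dvd_eval hp t n f hf hdeg a (by omega) U
        (fun x hx y hy hxy => hUi.1 hx hy (by
          exact Int.emod_eq_emod_iff_emod_sub_eq_zero.mpr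
            (Int.emod_eq_zero_of_dvd (by exact_mod_cast hxy))))
        (fun x hx => by exact_mod_cast hS x (hU hx))
      refine this.trans (n.lt_two_pow_self.le.trans (Nat.pow_le_pow_left ?_ _))
      rw [Nat.divisors_prime_pow hp]
      simp
  | coprime u v hu hv huv ihu ihv =>
    obtain ⟨b, hbu, hub, hb⟩ := ihu (by omega)
    obtain ⟨c, hcv, hvc, hc⟩ := ihv (by omega)
    have hbc : b.Coprime c := (huv.coprime_dvd_left hbu).coprime_dvd_right hcv
    refine ⟨b * c, mul_dvd_mul hbu hcv, by rw [mul_pow]; exact mul_dvd_mul hub hvc,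
      fun S hS => ?_⟩
    rw [hbc.card_divisors_mul, mul_pow]
    refine le_trans ?_ (Nat.mul_le_mul
      (hb S fun x hx => (Int.natCast_dvd_natCast.mpr (dvd_mul_right u v)).trans (hS x hx))
      (hc S fun x hx => (Int.natCast_dvd_natCast.mpr (dvd_mul_left v u)).trans (hS x hx)))
    rw [← Finset.card_product]
    have hb' : (b : ℤ) ∣ ((b * c : ℕ) : ℤ) := by simp
    have hc' : (c : ℤ) ∣ ((b * c : ℕ) : ℤ) := by simp
    refine Finset.card_le_card_of_injOn (fun r => (r % (b : ℤ), r % (c : ℤ))) ?_ ?_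
    · intro r hr
      obtain ⟨x, hx, rfl⟩ := Finset.mem_image.mp hr
      simp only [Finset.coe_product, Set.mem_prod, Finset.mem_coe, Finset.mem_image]
      exact ⟨⟨x, hx, (Int.emod_emod_of_dvd x hb').symm⟩, ⟨x, hx, (Int.emod_emod_of_dvd x hc').symm⟩⟩
    · intro r hr s hs hrs
      obtain ⟨x, hx, rfl⟩ := Finset.mem_image.mp hr
      obtain ⟨y, hy, rfl⟩ := Finset.mem_image.mp hs
      simp only [Prod.mk.injEq, Int.emod_emod_of_dvd _ hb', Int.emod_emod_of_dvd _ hc'] at hrs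
      have h1 : (b : ℤ) ∣ x - y := Int.dvd_of_emod_eq_zero
        (Int.emod_eq_emod_iff_emod_sub_eq_zero.mp hrs.1)
      have h2 : (c : ℤ) ∣ x - y := Int.dvd_of_emod_eq_zero
        (Int.emod_eq_emod_iff_emod_sub_eq_zero.mp hrs.2)
      refine Int.emod_eq_emod_iff_emod_sub_eq_zero.mpr (Int.emod_eq_zero_of_dvd ?_)
      push_cast
      exact (Nat.isCoprime_iff_coprime.mpr hbc).mul_dvd h1 h2

lemma card_le_of_card_image_emod {β N t : ℕ} (hβ : β ≠ 0) (S : Finset ℤ)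
    (hS : S ⊆ Finset.Icc 1 (N : ℤ)) (ht : (S.image (· % (β : ℤ))).card ≤ t) :
    S.card ≤ (N / β + 1) * t := by
  refine (Finset.card_le_mul_card_image (f := (· % (β : ℤ))) S (N / β + 1) fun r _ => ?_).trans
    (Nat.mul_le_mul_left _ ht)
  have : ∀ q : ℕ, (Finset.Icc (0 : ℤ) (q : ℤ)).card = q + 1 := fun q => by
    rw [Int.card_Icc]; omega
  rw [← this]
  have hβ' : (0 : ℤ) < β := by exact_mod_cast Nat.pos_of_ne_zero hβ
  refine Finset.card_le_card_of_injOn (· / (β : ℤ)) ?_ ?_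
  · intro x hx
    have hx := hS (Finset.mem_filter.mp hx).1
    simp only [Finset.mem_Icc, Finset.coe_Icc, Set.mem_Icc] at hx ⊢
    push_cast
    exact ⟨Int.ediv_nonneg (by omega) (by omega), Int.ediv_le_ediv hβ' hx.2⟩
  · intro x hx y hy hxy
    have hx := (Finset.mem_filter.mp hx).2
    have hy := (Finset.mem_filter.mp hy).2
    simp only at hxy
    rw [← Int.emod_add_mul_ediv x β, ← Int.emod_add_mul_ediv y β, hx, hy, hxy]

open Polynomial in
lemma sum_card_divisors_eval_pow_le {n : ℕ} (hn : 1 ≤ n) (B r M y : ℕ) (hy : 1 ≤ y)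
    (hyM : y * y ≤ M) (f : ℤ[X]) (hf : f.Monic) (hdeg : f.natDegree = n) (S : Finset ℤ)
    (hS : S ⊆ Finset.Icc 1 (M : ℤ)) (hne : ∀ x ∈ S, f.eval x ≠ 0)
    (hlt : ∀ x ∈ S, (f.eval x).natAbs < y ^ B) :
    ∑ x ∈ S, ((f.eval x).natAbs.divisors.card : ℝ) ^ r ≤
      2 ^ (B * r) * (2 * M * (1 + Real.log M) ^ 2 ^ (n * (B * r) + 2 * n)) := by
  set R := B * r with hR
  have hβ : ∀ δ : ℕ, ∃ β : ℕ, δ ≠ 0 → β ∣ δ ∧ δ ∣ β ^ n ∧ ∀ S : Finset ℤ,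
      (∀ x ∈ S, (δ : ℤ) ∣ f.eval x) →
      (S.image (· % (β : ℤ))).card ≤ β.divisors.card ^ n := fun δ => by
    by_cases hδ : δ = 0
    · exact ⟨0, fun h => absurd hδ h⟩
    · obtain ⟨β, h⟩ := exists_modulus hn f hf hdeg δ hδ
      exact ⟨β, fun _ => h⟩
  choose β hβ using hβ
  have hmem : ∀ δ ∈ Finset.Icc 1 M, β δ ∈ Finset.Icc 1 M := fun δ hδ => by
    rw [Finset.mem_Icc] at hδ ⊢
    have h := (hβ δ (by omega)).1
    exact ⟨Nat.pos_of_dvd_of_pos h hδ.1, (Nat.le_of_dvd hδ.1 h).trans hδ.2⟩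
  set G : ℕ → ℝ := fun b => (b.divisors.card : ℝ) ^ (n * R + n) / b with hG
  have hG0 : ∀ b, 0 ≤ G b := fun b => by positivity
  calc ∑ x ∈ S, ((f.eval x).natAbs.divisors.card : ℝ) ^ r
      ≤ ∑ x ∈ S, 2 ^ R * ∑ δ ∈ (Finset.Icc 1 M).filter fun δ : ℕ => (δ : ℤ) ∣ f.eval x,
          (δ.divisors.card : ℝ) ^ R := by
        refine Finset.sum_le_sum fun x hx => ?_
        obtain ⟨δ, hδ, hδM, hle⟩ := exists_small_divisor hy hyM B _
          (Int.natAbs_ne_zero.mpr (hne x hx)) (hlt x hx)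
        have hδ0 : 0 < δ := Nat.pos_of_dvd_of_pos hδ (Int.natAbs_pos.mpr (hne x hx))
        have h1 : ((f.eval x).natAbs.divisors.card : ℝ) ^ r ≤
            2 ^ R * (δ.divisors.card : ℝ) ^ R := by
          rw [hR, pow_mul, pow_mul, ← mul_pow]
          gcongr
          exact_mod_cast hle
        refine h1.trans ?_
        gcongr
        exact Finset.single_le_sum (f := fun δ : ℕ => (δ.divisors.card : ℝ) ^ R)
          (fun _ _ => by positivity)
          (Finset.mem_filter.mpr ⟨Finset.mem_Icc.mpr ⟨hδ0, hδM⟩, Int.natCast_dvd.mpr hδ⟩)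
    _ = 2 ^ R * ∑ δ ∈ Finset.Icc 1 M, (δ.divisors.card : ℝ) ^ R *
          (S.filter fun x => (δ : ℤ) ∣ f.eval x).card := by
        rw [← Finset.mul_sum]
        simp_rw [Finset.sum_filter]
        rw [Finset.sum_comm]
        simp_rw [← Finset.sum_filter, Finset.sum_const, nsmul_eq_mul, mul_comm]
    _ ≤ 2 ^ R * ∑ δ ∈ Finset.Icc 1 M, 2 * M * G (β δ) := by
        refine mul_le_mul_of_nonneg_left (Finset.sum_le_sum fun δ hδ => ?_) (by positivity)
        have hδ' := Finset.mem_Icc.mp hδ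
        have hb := Finset.mem_Icc.mp (hmem δ hδ)
        obtain ⟨h1, h2, h3⟩ := hβ δ (by omega)
        have hcard := card_le_of_card_image_emod (by omega) _
          ((Finset.filter_subset _ S).trans hS) (h3 (S.filter fun x => (δ : ℤ) ∣ f.eval x)
            fun x hx => (Finset.mem_filter.mp hx).2)
        have hdiv : δ.divisors.card ≤ (β δ).divisors.card ^ n :=
          (card_divisors_mono (pow_ne_zero _ (by omega)) h2).trans (card_divisors_pow_le _ _)
        have hb0 : (0 : ℝ) < β δ := by exact_mod_cast hb.1
        have hM : (((M / β δ : ℕ) : ℝ) + 1) ≤ 2 * M / β δ := by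
          have h4 : ((M / β δ : ℕ) : ℝ) ≤ M / β δ := Nat.cast_div_le
          have h5 : (1 : ℝ) ≤ M / β δ := by
            rw [le_div_iff₀ hb0]; exact_mod_cast (by omega : 1 * β δ ≤ M)
          rw [two_mul, add_div]; linarith
        calc (δ.divisors.card : ℝ) ^ R * (S.filter fun x => (δ : ℤ) ∣ f.eval x).card
            ≤ (((β δ).divisors.card : ℝ) ^ n) ^ R *
                ((((M / β δ : ℕ) : ℝ) + 1) * ((β δ).divisors.card : ℝ) ^ n) := by
              gcongr
              · exact_mod_cast hdiv
              · exact_mod_cast hcard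
          _ ≤ (((β δ).divisors.card : ℝ) ^ n) ^ R *
                ((2 * M / β δ) * ((β δ).divisors.card : ℝ) ^ n) := by gcongr
          _ = 2 * M * G (β δ) := by simp only [hG]; ring
    _ = 2 ^ R * (2 * M * ∑ b ∈ Finset.Icc 1 M, ∑ δ ∈ (Finset.Icc 1 M).filter (β · = b), G b) := by
        rw [← Finset.mul_sum, ← Finset.sum_fiberwise_of_maps_to hmem]
        congr 2
        refine Finset.sum_congr rfl fun b _ => Finset.sum_congr rfl fun δ hδ => ?_
        rw [(Finset.mem_filter.mp hδ).2]
    _ ≤ 2 ^ R * (2 * M * ∑ b ∈ Finset.Icc 1 M, (b.divisors.card : ℝ) ^ (n * R + 2 * n) / b) := by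
        gcongr with b hb
        rw [Finset.sum_const, nsmul_eq_mul]
        have hb := Finset.mem_Icc.mp hb
        have h1 : ((Finset.Icc 1 M).filter (β · = b)).card ≤ b.divisors.card ^ n := by
          refine (Finset.card_le_card fun δ hδ => ?_).trans (card_divisors_pow_le b n)
          rw [Finset.mem_filter, Finset.mem_Icc] at hδ
          rw [Nat.mem_divisors, ← hδ.2]
          exact ⟨(hβ δ (by omega)).2.1, pow_ne_zero _ (by omega)⟩
        calc (((Finset.Icc 1 M).filter (β · = b)).card : ℝ) * G b
            ≤ (b.divisors.card : ℝ) ^ n * G b := by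
              refine mul_le_mul_of_nonneg_right ?_ (hG0 b)
              exact_mod_cast h1
          _ = _ := by simp only [hG]; ring
    _ ≤ _ := by
        gcongr
        exact sum_card_divisors_pow_div_le _ _

open Polynomial in
/-- Moments of the divisor function along monic polynomials. -/
lemma exists_moment_bound_monic {n : ℕ} (hn : 1 ≤ n) (Q b r : ℕ) :
    ∃ C : ℝ, 0 ≤ C ∧ ∃ c : ℕ, ∀ f : ℤ[X], f.Monic → f.natDegree = n → ∀ M : ℕ, 1 ≤ M →
      ∀ S ⊆ Finset.Icc 1 (M : ℤ), (∀ x ∈ S, f.eval x ≠ 0) →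
      (∀ x ∈ S, (f.eval x).natAbs ≤ Q * M ^ b) →
      ∑ x ∈ S, ((f.eval x).natAbs.divisors.card : ℝ) ^ r ≤ C * M * (1 + Real.log M) ^ c := by
  set B := Q + 4 * b with hB
  set c := 2 ^ (n * (B * r) + 2 * n) with hc
  refine ⟨2 ^ (B * r) * (8 * 3 ^ c), by positivity, c, fun f hf hdeg M hM S hS hne hle => ?_⟩
  set y := Nat.sqrt (4 * M) with hy
  have hy2 : 2 ≤ y := Nat.le_sqrt.mpr (by omega)
  have hyM : y * y ≤ 4 * M := Nat.sqrt_le _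
  have hMy : M ≤ y ^ 4 := by
    have h1 : 4 * M < (y + 1) * (y + 1) := Nat.lt_succ_sqrt _
    have h2 : y + 1 ≤ y ^ 2 := by nlinarith
    nlinarith
  have hlt : ∀ x ∈ S, (f.eval x).natAbs < y ^ B := fun x hx =>
    calc (f.eval x).natAbs ≤ Q * M ^ b := hle x hx
      _ < 2 ^ Q * M ^ b := by
        gcongr
        exact Nat.lt_two_pow_self
      _ ≤ y ^ Q * (y ^ 4) ^ b := by gcongr
      _ = y ^ B := by rw [← pow_mul, ← pow_add]
  have h := sum_card_divisors_eval_pow_le hn B r (4 * M) y (by omega) hyM f hf hdeg S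
    (hS.trans (Finset.Icc_subset_Icc le_rfl (by push_cast; omega))) hne hlt
  have hM1 : (1 : ℝ) ≤ M := by exact_mod_cast hM
  have hlogM := Real.log_nonneg hM1
  have hlog : 1 + Real.log ((4 * M : ℕ) : ℝ) ≤ 3 * (1 + Real.log M) := by
    push_cast
    rw [Real.log_mul (by norm_num) (by positivity), show (4 : ℝ) = 2 ^ 2 by norm_num, Real.log_pow]
    have := Real.log_two_lt_d9
    push_cast
    linarith
  have h4 : (0 : ℝ) ≤ Real.log ((4 * M : ℕ) : ℝ) := Real.log_natCast_nonneg _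
  calc _ ≤ _ := h
    _ ≤ 2 ^ (B * r) * (2 * ((4 * M : ℕ) : ℝ) * (3 * (1 + Real.log M)) ^ c) := by gcongr
    _ = _ := by push_cast; rw [mul_pow]; ring

open Polynomial in
/-- Moments of the divisor function along polynomials with fixed positive leading coefficient. -/
lemma exists_moment_bound {n : ℕ} (hn : 1 ≤ n) {a : ℕ} (ha : 1 ≤ a) (Q b r : ℕ) :
    ∃ C : ℝ, 0 ≤ C ∧ ∃ c : ℕ, ∀ f : ℤ[X], f.leadingCoeff = a → f.natDegree = n → ∀ M : ℕ, 1 ≤ M →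
      ∀ S ⊆ Finset.Icc 1 (M : ℤ), (∀ x ∈ S, f.eval x ≠ 0) →
      (∀ x ∈ S, (f.eval x).natAbs ≤ Q * M ^ b) →
      ∑ x ∈ S, ((f.eval x).natAbs.divisors.card : ℝ) ^ r ≤ C * M * (1 + Real.log M) ^ c := by
  obtain ⟨C, hC, c, h⟩ := exists_moment_bound_monic hn (a ^ (n - 1) * Q) b r
  refine ⟨C * a * (1 + Real.log a) ^ c, ?_, c, fun f hf hdeg M hM S hS hne hle => ?_⟩
  · have := Real.log_natCast_nonneg a
    positivity
  have ha0 : (a : ℤ) ≠ 0 := by exact_mod_cast (by omega : a ≠ 0)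
  have hf0 : f ≠ 0 := by
    rintro rfl
    simp at hf; omega
  have hinj : Function.Injective fun x : ℤ => (a : ℤ) * x := mul_right_injective₀ ha0
  have hev : ∀ x : ℤ, (integralNormalization f).eval (a * x) = a ^ (n - 1) * f.eval x := fun x => by
    have := integralNormalization_eval₂_leadingCoeff_mul (p := f) (by omega) (RingHom.id ℤ) x
    rw [hf, hdeg] at this
    simpa [eval₂_id] using this
  have hm := h (integralNormalization f) (monic_integralNormalization hf0)
    (by rw [natDegree_integralNormalization, hdeg]) (a * M)
    (Nat.mul_pos ha hM) (S.image fun x => (a : ℤ) * x)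
    (fun y hy => by
      obtain ⟨x, hx, rfl⟩ := Finset.mem_image.mp hy
      have := Finset.mem_Icc.mp (hS hx)
      have ha1 : (1 : ℤ) ≤ a := by exact_mod_cast ha
      rw [Finset.mem_Icc]
      push_cast
      constructor <;> nlinarith)
    (fun y hy => by
      obtain ⟨x, hx, rfl⟩ := Finset.mem_image.mp hy
      rw [hev]
      exact mul_ne_zero (pow_ne_zero _ ha0) (hne x hx))
    (fun y hy => by
      obtain ⟨x, hx, rfl⟩ := Finset.mem_image.mp hy
      rw [hev, Int.natAbs_mul, Int.natAbs_pow, Int.natAbs_natCast, mul_assoc]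
      gcongr
      refine (hle x hx).trans ?_
      gcongr
      exact Nat.le_mul_of_pos_left _ ha)
  rw [Finset.sum_image hinj.injOn] at hm
  have hM1 : (1 : ℝ) ≤ M := by exact_mod_cast hM
  have ha1 : (1 : ℝ) ≤ a := by exact_mod_cast ha
  have hlogM := Real.log_nonneg hM1
  have hloga := Real.log_nonneg ha1
  calc ∑ x ∈ S, ((f.eval x).natAbs.divisors.card : ℝ) ^ r
      ≤ ∑ x ∈ S, (((integralNormalization f).eval ((a : ℤ) * x)).natAbs.divisors.card : ℝ) ^ r := by
        refine Finset.sum_le_sum fun x hx => pow_le_pow_left₀ (by positivity) ?_ r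
        refine Nat.cast_le.mpr (card_divisors_mono ?_ ?_)
        · rw [hev, Int.natAbs_ne_zero]
          exact mul_ne_zero (pow_ne_zero _ ha0) (hne x hx)
        · rw [hev]
          exact Int.natAbs_dvd_natAbs.mpr (dvd_mul_left _ _)
    _ ≤ C * ((a * M : ℕ) : ℝ) * (1 + Real.log ((a * M : ℕ) : ℝ)) ^ c := hm
    _ ≤ C * (a * M) * ((1 + Real.log a) * (1 + Real.log M)) ^ c := by
        push_cast
        rw [Real.log_mul (by positivity) (by positivity)]
        gcongr
        nlinarith
    _ = _ := by rw [mul_pow]; ring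

open Polynomial in
/-- The polynomial `(f(X + h) - f(X)) / h`. -/
noncomputable def diffQuot (h : ℤ) (f : ℤ[X]) : ℤ[X] :=
  ∑ i ∈ Finset.range f.natDegree, C (h ^ i) * hasseDeriv (i + 1) f

open Polynomial in
lemma mul_eval_diffQuot (h : ℤ) (f : ℤ[X]) (x : ℤ) :
    h * (diffQuot h f).eval x = f.eval (x + h) - f.eval x := by
  have h1 : f.eval (x + h) =
      ∑ i ∈ Finset.range (f.natDegree + 1), (hasseDeriv i f).eval x * h ^ i := by
    rw [add_comm, ← taylor_eval, eval_eq_sum_range, natDegree_taylor]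
    simp_rw [taylor_coeff]
  rw [h1, Finset.sum_range_succ', diffQuot, eval_finsetSum, Finset.mul_sum]
  simp only [eval_mul, eval_C, pow_zero, mul_one, hasseDeriv_zero', add_sub_cancel_right]
  exact Finset.sum_congr rfl fun i _ => by ring

open Polynomial in
lemma coeff_diffQuot (h : ℤ) (f : ℤ[X]) (m : ℕ) :
    (diffQuot h f).coeff m = ∑ i ∈ Finset.range f.natDegree,
      h ^ i * (((m + (i + 1)).choose (i + 1) : ℤ) * f.coeff (m + (i + 1))) := by
  rw [diffQuot, finsetSum_coeff]
  simp_rw [coeff_C_mul, hasseDeriv_coeff]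

open Polynomial in
lemma natDegree_diffQuot_and_leadingCoeff (h : ℤ) {f : ℤ[X]} {n : ℕ} (hf : f.natDegree = n + 1) :
    (diffQuot h f).natDegree = n ∧ (diffQuot h f).leadingCoeff = (n + 1) * f.leadingCoeff := by
  have hn : (diffQuot h f).coeff n = (n + 1) * f.leadingCoeff := by
    rw [coeff_diffQuot, hf, Finset.sum_range_succ', Finset.sum_eq_zero]
    · simp [leadingCoeff, hf]
    · intro i _
      rw [coeff_eq_zero_of_natDegree_lt (by omega)]
      simp
  have hlt : (diffQuot h f).natDegree ≤ n := natDegree_le_iff_coeff_eq_zero.mpr fun m hm => by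
    rw [coeff_diffQuot, Finset.sum_eq_zero]
    intro i _
    rw [coeff_eq_zero_of_natDegree_lt (by omega)]
    simp
  have h0 : f ≠ 0 := by
    rintro rfl
    simp at hf
  have hdeg : (diffQuot h f).natDegree = n := by
    refine natDegree_eq_of_le_of_coeff_ne_zero hlt ?_
    rw [hn]
    exact mul_ne_zero (by positivity) (leadingCoeff_ne_zero.mpr h0)
  exact ⟨hdeg, by rw [leadingCoeff, hdeg, hn]⟩

/-- The lists of `j` integers of absolute value less than `N`. -/
noncomputable def shiftLists (N : ℕ) : ℕ → Finset (List ℤ)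
  | 0 => {[]}
  | j + 1 => (shiftLists N j ×ˢ Finset.Ioo (-(N : ℤ)) N).image fun u => u.2 :: u.1

lemma sum_shiftLists_succ {M : Type*} [AddCommMonoid M] (N j : ℕ) (F : List ℤ → M) :
    ∑ l ∈ shiftLists N (j + 1), F l =
      ∑ l ∈ shiftLists N j, ∑ h ∈ Finset.Ioo (-(N : ℤ)) N, F (h :: l) := by
  rw [shiftLists, Finset.sum_image, Finset.sum_product]
  rintro ⟨l, h⟩ _ ⟨l', h'⟩ _ heq
  simp only [List.cons.injEq] at heq
  rw [heq.1, heq.2]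

lemma mem_shiftLists_succ {N j : ℕ} {l : List ℤ} : l ∈ shiftLists N (j + 1) ↔
    ∃ h ∈ Finset.Ioo (-(N : ℤ)) N, ∃ l' ∈ shiftLists N j, l = h :: l' := by
  simp only [shiftLists, Finset.mem_image, Finset.mem_product, Prod.exists]
  constructor
  · rintro ⟨l', h, ⟨hl, hh⟩, rfl⟩
    exact ⟨h, hh, l', hl, rfl⟩
  · rintro ⟨h, hh, l', hl, rfl⟩
    exact ⟨l', h, ⟨hl, hh⟩, rfl⟩

lemma card_Ioo_neg_le (N : ℕ) : (Finset.Ioo (-(N : ℤ)) N).card ≤ 2 * N := by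
  rw [Int.card_Ioo]; omega

lemma card_shiftLists_le (N j : ℕ) : (shiftLists N j).card ≤ (2 * N) ^ j := by
  induction j with
  | zero => simp [shiftLists]
  | succ j ih =>
    rw [shiftLists, pow_succ]
    refine Finset.card_image_le.trans ?_
    rw [Finset.card_product]
    exact Nat.mul_le_mul ih (card_Ioo_neg_le N)

lemma mul_card_shiftLists_prod_eq_zero_le {N : ℕ} (j : ℕ) :
    N * ((shiftLists N j).filter (·.prod = 0)).card ≤ j * (2 * N) ^ j := by
  induction j with
  | zero => simp [shiftLists, Finset.filter_singleton]
  | succ j ih =>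
    have h1 : ((shiftLists N (j + 1)).filter (·.prod = 0)).card ≤
        (shiftLists N j).card + 2 * N * ((shiftLists N j).filter (·.prod = 0)).card := by
      rw [Finset.card_filter, sum_shiftLists_succ]
      calc _ ≤ ∑ l ∈ shiftLists N j, (1 + if l.prod = 0 then 2 * N else 0) := by
            refine Finset.sum_le_sum fun l _ => ?_
            rw [← Finset.card_filter]
            by_cases hl : l.prod = 0
            · simp only [hl, if_true]
              exact (Finset.card_filter_le _ _).trans ((card_Ioo_neg_le N).trans (by omega))
            · simp only [hl, if_false, List.prod_cons, mul_eq_zero, or_false]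
              exact Finset.card_le_one.mpr fun a ha b hb => by
                rw [(Finset.mem_filter.mp ha).2, (Finset.mem_filter.mp hb).2]
        _ = _ := by
          rw [Finset.sum_add_distrib, ← Finset.sum_filter]
          simp [mul_comm]
    calc _ ≤ N * ((shiftLists N j).card +
            2 * N * ((shiftLists N j).filter (·.prod = 0)).card) := by gcongr
      _ = N * (shiftLists N j).card +
            2 * N * (N * ((shiftLists N j).filter (·.prod = 0)).card) := by ring
      _ ≤ N * (2 * N) ^ j + 2 * N * (j * (2 * N) ^ j) := by
          gcongr
          exact card_shiftLists_le N j
      _ ≤ 2 * (N * (2 * N) ^ j) + 2 * N * (j * (2 * N) ^ j) := by omega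
      _ = _ := by ring

lemma card_filter_dvd_le {m : ℤ} (hm : m ≠ 0) (s : Finset ℤ) :
    (s.filter (· ∣ m)).card ≤ 2 * m.natAbs.divisors.card := by
  have hsub : s.filter (· ∣ m) ⊆ m.natAbs.divisors.image (fun d : ℕ => (d : ℤ)) ∪
      m.natAbs.divisors.image (fun d : ℕ => -(d : ℤ)) := by
    intro h hh
    have hd : h.natAbs ∈ m.natAbs.divisors := Nat.mem_divisors.mpr
      ⟨Int.natAbs_dvd_natAbs.mpr (Finset.mem_filter.mp hh).2, Int.natAbs_ne_zero.mpr hm⟩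
    rw [Finset.mem_union, Finset.mem_image, Finset.mem_image]
    rcases Int.natAbs_eq h with e | e
    · exact Or.inl ⟨_, hd, e.symm⟩
    · exact Or.inr ⟨_, hd, e.symm⟩
  refine (Finset.card_le_card hsub).trans ((Finset.card_union_le _ _).trans ?_)
  rw [two_mul]
  exact Nat.add_le_add Finset.card_image_le Finset.card_image_le

lemma card_shiftLists_dvd_le {m : ℤ} (hm : m ≠ 0) (N j : ℕ) :
    ((shiftLists N j).filter fun l => ∀ h ∈ l, h ∣ m).card ≤ (2 * m.natAbs.divisors.card) ^ j := by
  induction j with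
  | zero => 
    simpa [shiftLists] using Finset.card_filter_le (shiftLists N 0) fun l => ∀ h ∈ l, h ∣ m
  | succ j ih =>
    rw [Finset.card_filter, sum_shiftLists_succ, pow_succ]
    calc _ = ∑ l ∈ (shiftLists N j).filter (fun l => ∀ h ∈ l, h ∣ m),
            ((Finset.Ioo (-(N : ℤ)) N).filter (· ∣ m)).card := by
          rw [Finset.sum_filter]
          refine Finset.sum_congr rfl fun l _ => ?_
          by_cases hl : ∀ h ∈ l, h ∣ m
          · rw [if_pos hl, Finset.card_filter]
            exact Finset.sum_congr rfl fun h _ => by simp [and_iff_left hl]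
          · rw [if_neg hl]
            exact Finset.sum_eq_zero fun h _ =>
              if_neg fun hc => hl fun x hx => hc x (List.mem_cons_of_mem _ hx)
      _ ≤ _ := by
          rw [Finset.sum_const, smul_eq_mul]
          exact Nat.mul_le_mul ih (card_filter_dvd_le hm _)

lemma sum_shiftLists_prod_map (N j : ℕ) (w : ℤ → ℝ) :
    ∑ l ∈ shiftLists N j, (l.map w).prod = (∑ h ∈ Finset.Ioo (-(N : ℤ)) N, w h) ^ j := by
  induction j with
  | zero => simp [shiftLists]
  | succ j ih =>
    rw [sum_shiftLists_succ, pow_succ, ← ih, Finset.sum_mul]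
    refine Finset.sum_congr rfl fun l _ => ?_
    simp only [List.map_cons, List.prod_cons]
    rw [← Finset.sum_mul, mul_comm]

lemma card_divisors_prod_pow_le (l : List ℤ) (r : ℕ) :
    (l.prod.natAbs.divisors.card : ℝ) ^ r ≤
      (l.map fun h => (h.natAbs.divisors.card : ℝ) ^ r).prod := by
  induction l with
  | nil => simp
  | cons h l ih =>
    rw [List.prod_cons, Int.natAbs_mul, List.map_cons, List.prod_cons]
    calc _ ≤ ((h.natAbs.divisors.card : ℝ) * l.prod.natAbs.divisors.card) ^ r := by
          gcongr
          exact_mod_cast card_divisors_mul_le _ _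
      _ ≤ _ := by rw [mul_pow]; gcongr

lemma sum_Ioo_card_divisors_pow_le {N : ℕ} (hN : 1 ≤ N) (r : ℕ) :
    ∑ h ∈ Finset.Ioo (-(N : ℤ)) N, (h.natAbs.divisors.card : ℝ) ^ r ≤
      3 * N * (1 + Real.log N) ^ 2 ^ r := by
  have hN1 : (1 : ℝ) ≤ N := by exact_mod_cast hN
  have hL : (1 : ℝ) ≤ (1 + Real.log N) ^ 2 ^ r :=
    one_le_pow₀ (by linarith [Real.log_nonneg hN1])
  set w : ℕ → ℝ := fun q => (q.divisors.card : ℝ) ^ r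
  have hpos : ∑ q ∈ Finset.Icc 1 N, w q ≤ N * (1 + Real.log N) ^ 2 ^ r := by
    refine le_trans ?_ (mul_le_mul_of_nonneg_left (sum_card_divisors_pow_div_le N r)
      (by positivity))
    rw [Finset.mul_sum]
    refine Finset.sum_le_sum fun q hq => ?_
    have hq := Finset.mem_Icc.mp hq
    have hq0 : (0 : ℝ) < q := by exact_mod_cast hq.1
    have hqN : (q : ℝ) ≤ N := by exact_mod_cast hq.2
    rw [mul_div_assoc', le_div_iff₀ hq0, mul_comm]
    exact mul_le_mul_of_nonneg_right hqN (by positivity)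
  have hsub : Finset.Ioo (-(N : ℤ)) N ⊆ ({0} ∪ (Finset.Icc 1 N).image (fun q : ℕ => (q : ℤ))) ∪
      (Finset.Icc 1 N).image (fun q : ℕ => -(q : ℤ)) := by
    intro h hh
    have hh := Finset.mem_Ioo.mp hh
    simp only [Finset.mem_union, Finset.mem_singleton, Finset.mem_image, Finset.mem_Icc]
    rcases lt_trichotomy h 0 with h0 | h0 | h0
    · exact Or.inr ⟨h.natAbs, by omega, by omega⟩
    · exact Or.inl (Or.inl h0)
    · exact Or.inl (Or.inr ⟨h.natAbs, by omega, by omega⟩)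
  have hunion : ∀ (s t : Finset ℤ), ∑ h ∈ s ∪ t, w h.natAbs ≤
      ∑ h ∈ s, w h.natAbs + ∑ h ∈ t, w h.natAbs := fun s t => by
    rw [← Finset.sum_union_inter]
    exact le_add_of_nonneg_right (Finset.sum_nonneg fun _ _ => by positivity)
  have h0 : w 0 ≤ 1 := by
    simp only [w, Nat.divisors_zero, Finset.card_empty, Nat.cast_zero]
    exact pow_le_one₀ le_rfl zero_le_one
  have hle := (Finset.sum_le_sum_of_subset_of_nonneg hsub fun (h : ℤ) _ _ =>
    (by positivity : 0 ≤ w h.natAbs)).trans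
      ((hunion _ _).trans (add_le_add_left (hunion _ _) _))
  rw [Finset.sum_singleton, Finset.sum_image (fun a _ b _ h => by simpa using h),
    Finset.sum_image (fun a _ b _ h => by simpa using h)] at hle
  simp only [Int.natAbs_natCast, Int.natAbs_neg, Int.natAbs_zero] at hle
  nlinarith

open Polynomial in
lemma card_filter_eval_eq_le {f : ℤ[X]} (hf : 1 ≤ f.natDegree) (v : ℤ) (J : Finset ℤ) :
    (J.filter fun x => f.eval x = v).card ≤ f.natDegree := by
  have hdeg : 0 < f.degree := natDegree_pos_iff_degree_pos.mp hf
  refine le_trans ?_ (card_roots_sub_C' (a := v) hdeg)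
  refine le_trans (Finset.card_le_card fun x hx => ?_) (Multiset.toFinset_card_le _)
  have hne : f - C v ≠ 0 := fun h => by
    rw [sub_eq_zero.mp h, natDegree_C] at hf
    omega
  rw [Multiset.mem_toFinset, mem_roots hne, IsRoot, eval_sub, eval_C,
    (Finset.mem_filter.mp hx).2, sub_self]

open Polynomial in
/-- The iterated difference quotient of `X ^ k`. -/
noncomputable def diffPoly (k : ℕ) : List ℤ → ℤ[X]
  | [] => X ^ k
  | h :: l => diffQuot h (diffPoly k l)

/-- The points all of whose shifts remain in `[1, N]`. -/
noncomputable def shiftDomain (N : ℕ) : List ℤ → Finset ℤ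
  | [] => Finset.Icc 1 (N : ℤ)
  | h :: l => (shiftDomain N l).filter fun x => x + h ∈ shiftDomain N l

/-- The iterated difference of `x ^ k`. -/
noncomputable def diffPhase (k : ℕ) (l : List ℤ) (x : ℤ) : ℤ := l.prod * (diffPoly k l).eval x

lemma diffPhase_cons (k : ℕ) (h : ℤ) (l : List ℤ) (x : ℤ) :
    diffPhase k (h :: l) x = diffPhase k l (x + h) - diffPhase k l x := by
  simp only [diffPhase, diffPoly, List.prod_cons]
  rw [← mul_sub, ← mul_eval_diffQuot]
  ring

lemma shiftDomain_subset (N : ℕ) (l : List ℤ) : shiftDomain N l ⊆ Finset.Icc 1 (N : ℤ) := by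
  induction l with
  | nil => exact subset_rfl
  | cons h l ih => exact (Finset.filter_subset _ _).trans ih

lemma diffPoly_natDegree_and_leadingCoeff {k N j : ℕ} (hj : j ≤ k) {l : List ℤ}
    (hl : l ∈ shiftLists N j) :
    (diffPoly k l).natDegree = k - j ∧ (diffPoly k l).leadingCoeff = k.descFactorial j := by
  induction j generalizing l with
  | zero =>
    obtain rfl : l = [] := by simpa [shiftLists] using hl
    simp [diffPoly]
  | succ j ih =>
    obtain ⟨h, -, l, hl', rfl⟩ := mem_shiftLists_succ.mp hl
    obtain ⟨h1, h2⟩ := ih (by omega) hl'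
    obtain ⟨h3, h4⟩ := natDegree_diffQuot_and_leadingCoeff h (f := diffPoly k l)
      (n := k - (j + 1)) (by omega)
    refine ⟨h3, h4.trans ?_⟩
    rw [h2, Nat.descFactorial_succ]
    have : (((k - (j + 1) : ℕ) : ℤ) + 1) = ((k - j : ℕ) : ℤ) := by omega
    rw [this]
    push_cast
    rfl

lemma abs_eval_diffPoly_le {k N j : ℕ} {l : List ℤ} (hl : l ∈ shiftLists N j)
    (hl0 : l.prod ≠ 0) {M : ℕ} {x : ℤ} (hx : |x| ≤ M) :
    |(diffPoly k l).eval x| ≤ 2 ^ j * ((M : ℤ) + j * N) ^ k := by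
  induction j generalizing l M x with
  | zero =>
    obtain rfl : l = [] := by simpa [shiftLists] using hl
    simpa [diffPoly, abs_pow] using pow_le_pow_left₀ (abs_nonneg x) hx k
  | succ j ih =>
    obtain ⟨h, hh, l, hl', rfl⟩ := mem_shiftLists_succ.mp hl
    rw [List.prod_cons, mul_ne_zero_iff] at hl0
    rw [Finset.mem_Ioo] at hh
    rw [abs_le] at hx
    have hM : ∀ y : ℤ, |y| ≤ ((M + N : ℕ) : ℤ) →
        |(diffPoly k l).eval y| ≤ 2 ^ j * (((M + N : ℕ) : ℤ) + j * N) ^ k := fun y => ih hl' hl0.2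
    have h1 := hM (x + h) (by rw [abs_le]; push_cast; omega)
    have h2 := hM x (by rw [abs_le]; push_cast; omega)
    calc |(diffPoly k (h :: l)).eval x| ≤ |h| * |(diffPoly k (h :: l)).eval x| :=
          le_mul_of_one_le_left (abs_nonneg _) (Int.one_le_abs hl0.1)
      _ = |(diffPoly k l).eval (x + h) - (diffPoly k l).eval x| := by
          rw [← abs_mul, diffPoly, mul_eval_diffQuot]
      _ ≤ 2 ^ j * (((M + N : ℕ) : ℤ) + j * N) ^ k + 2 ^ j * (((M + N : ℕ) : ℤ) + j * N) ^ k :=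
          (abs_sub _ _).trans (add_le_add h1 h2)
      _ = _ := by push_cast; ring

lemma natAbs_eval_diffPoly_le {k N j : ℕ} {l : List ℤ} (hl : l ∈ shiftLists N j)
    (hl0 : l.prod ≠ 0) {x : ℤ} (hx : x ∈ Finset.Icc 1 (N : ℤ)) :
    ((diffPoly k l).eval x).natAbs ≤ 2 ^ j * (j + 1) ^ k * N ^ k := by
  have hx := Finset.mem_Icc.mp hx
  have := abs_eval_diffPoly_le (k := k) hl hl0 (M := N) (x := x) (by rw [abs_le]; omega)
  zify
  refine this.trans (le_of_eq ?_)
  rw [mul_assoc, ← mul_pow]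
  ring

/-- The index set of the differenced sum. -/
noncomputable def shiftPairs (N j : ℕ) : Finset (Σ _ : List ℤ, ℤ) :=
  (shiftLists N j).sigma (shiftDomain N)

lemma card_filter_shiftPairs (N j : ℕ) (P : (Σ _ : List ℤ, ℤ) → Prop) [DecidablePred P] :
    ((shiftPairs N j).filter P).card =
      ∑ l ∈ shiftLists N j, ((shiftDomain N l).filter fun x => P ⟨l, x⟩).card := by
  simp_rw [Finset.card_filter]
  rw [shiftPairs, Finset.sum_sigma]

lemma card_diffPhase_eq_zero_le {k N j : ℕ} (hj : j < k) :
    ((shiftPairs N j).filter fun e => diffPhase k e.1 e.2 = 0).card ≤ (j + k) * (2 * N) ^ j := by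
  rw [card_filter_shiftPairs]
  calc _ ≤ ∑ l ∈ shiftLists N j, ((if l.prod = 0 then N else 0) + k) := by
        refine Finset.sum_le_sum fun l hl => ?_
        by_cases hl0 : l.prod = 0
        · rw [if_pos hl0]
          refine (Finset.card_filter_le _ _).trans ((Finset.card_le_card
            (shiftDomain_subset N l)).trans ?_)
          rw [Int.card_Icc]; omega
        · obtain ⟨h1, -⟩ := diffPoly_natDegree_and_leadingCoeff hj.le hl
          simp only [diffPhase, mul_eq_zero, hl0, false_or, if_false, zero_add]
          exact (card_filter_eval_eq_le (by omega) 0 _).trans (by omega)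
    _ = N * ((shiftLists N j).filter (·.prod = 0)).card + (shiftLists N j).card * k := by
        rw [Finset.sum_add_distrib, ← Finset.sum_filter]
        simp [mul_comm]
    _ ≤ j * (2 * N) ^ j + (2 * N) ^ j * k := by
        exact Nat.add_le_add (mul_card_shiftLists_prod_eq_zero_le j)
          (Nat.mul_le_mul_right _ (card_shiftLists_le N j))
    _ = _ := by ring

lemma dvd_of_mem_of_dvd_prod {l : List ℤ} {m h : ℤ} (hm : l.prod ∣ m) (hh : h ∈ l) : h ∣ m :=
  (List.dvd_prod hh).trans hm

lemma card_diffPhase_eq_le {k N j : ℕ} (hj : j < k) {m : ℤ} (hm : m ≠ 0) :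
    ((shiftPairs N j).filter fun e => diffPhase k e.1 e.2 = m).card ≤
      k * (2 * m.natAbs.divisors.card) ^ j := by
  rw [card_filter_shiftPairs]
  calc _ ≤ ∑ l ∈ shiftLists N j, if ∀ h ∈ l, h ∣ m then k else 0 := by
        refine Finset.sum_le_sum fun l hl => ?_
        rcases ((shiftDomain N l).filter fun x => diffPhase k l x = m).eq_empty_or_nonempty with
          he | ⟨x₀, hx₀⟩
        · rw [he]; exact Nat.zero_le _
        have hx₀ := (Finset.mem_filter.mp hx₀).2
        rw [if_pos fun h hh => dvd_of_mem_of_dvd_prod ⟨_, hx₀.symm⟩ hh]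
        have hl0 : l.prod ≠ 0 := fun h => hm (by rw [← hx₀, diffPhase, h, zero_mul])
        obtain ⟨h1, -⟩ := diffPoly_natDegree_and_leadingCoeff hj.le hl
        refine le_trans (Finset.card_le_card fun x hx => ?_) ((card_filter_eval_eq_le
          (f := diffPoly k l) (by omega) ((diffPoly k l).eval x₀) (shiftDomain N l)).trans
            (by omega : _ ≤ k))
        rw [Finset.mem_filter] at hx ⊢
        exact ⟨hx.1, mul_left_cancel₀ hl0 (hx.2.trans hx₀.symm)⟩
    _ = ((shiftLists N j).filter fun l => ∀ h ∈ l, h ∣ m).card * k := by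
        rw [← Finset.sum_filter, Finset.sum_const, smul_eq_mul]
    _ ≤ _ := by
        rw [mul_comm]
        exact Nat.mul_le_mul_left _ (card_shiftLists_dvd_le hm N j)

/-- The number of coincidences among the nonzero values of the differenced phase. -/
lemma exists_sum_card_coincidences_le {k j : ℕ} (hj : j < k) :
    ∃ C : ℝ, 0 ≤ C ∧ ∃ c : ℕ, ∀ N : ℕ, 1 ≤ N →
      ∑ e ∈ (shiftPairs N j).filter (fun e => diffPhase k e.1 e.2 ≠ 0),
        (((shiftPairs N j).filter fun e' =>
          diffPhase k e'.1 e'.2 = diffPhase k e.1 e.2).card : ℝ) ≤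
        C * (N : ℝ) ^ (j + 1) * (1 + Real.log N) ^ c := by
  obtain ⟨C, hC, c, h⟩ := exists_moment_bound (n := k - j) (by omega)
    (a := k.descFactorial j) (Nat.descFactorial_pos.mpr hj.le) (2 ^ j * (j + 1) ^ k) k j
  refine ⟨k * 2 ^ j * (3 ^ j * C), by positivity, 2 ^ j * j + c, fun N hN => ?_⟩
  set L := 1 + Real.log N with hL
  have hN1 : (1 : ℝ) ≤ N := by exact_mod_cast hN
  have hL1 : 1 ≤ L := by linarith [Real.log_nonneg hN1]
  set w : ℤ → ℝ := fun h => (h.natAbs.divisors.card : ℝ) ^ j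
  have hw : ∀ l : List ℤ, 0 ≤ (l.map w).prod := fun l =>
    List.prod_nonneg fun a ha => by
      obtain ⟨h, -, rfl⟩ := List.mem_map.mp ha
      positivity
  calc _ ≤ ∑ e ∈ (shiftPairs N j).filter (fun e => diffPhase k e.1 e.2 ≠ 0),
        k * 2 ^ j * ((e.1.map w).prod * w ((diffPoly k e.1).eval e.2)) := by
        refine Finset.sum_le_sum fun e he => ?_
        have h1 := card_diffPhase_eq_le (N := N) hj (Finset.mem_filter.mp he).2
        calc _ ≤ ((k * (2 * (diffPhase k e.1 e.2).natAbs.divisors.card) ^ j : ℕ) : ℝ) :=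
              Nat.cast_le.mpr h1
          _ = k * 2 ^ j * w (e.1.prod * (diffPoly k e.1).eval e.2) := by
              simp only [w, diffPhase]; push_cast; ring
          _ ≤ k * 2 ^ j * (w e.1.prod * w ((diffPoly k e.1).eval e.2)) := by
              gcongr
              simp only [w]
              rw [← mul_pow, Int.natAbs_mul]
              gcongr
              exact_mod_cast card_divisors_mul_le _ _
          _ ≤ _ := by
              gcongr
              exact card_divisors_prod_pow_le _ _
    _ = k * 2 ^ j * ∑ l ∈ shiftLists N j, (l.map w).prod *
          ∑ x ∈ (shiftDomain N l).filter (fun x => diffPhase k l x ≠ 0),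
            w ((diffPoly k l).eval x) := by
        rw [← Finset.mul_sum, Finset.sum_filter, shiftPairs, Finset.sum_sigma]
        congr 1
        refine Finset.sum_congr rfl fun l _ => ?_
        rw [Finset.mul_sum, Finset.sum_filter]
    _ ≤ k * 2 ^ j * ∑ l ∈ shiftLists N j, (l.map w).prod * (C * N * L ^ c) := by
        refine mul_le_mul_of_nonneg_left (Finset.sum_le_sum fun l hl =>
          mul_le_mul_of_nonneg_left ?_ (hw l)) (by positivity)
        by_cases hl0 : l.prod = 0
        · have : (shiftDomain N l).filter (fun x => diffPhase k l x ≠ 0) = ∅ := by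
            simp [diffPhase, hl0]
          rw [this, Finset.sum_empty]
          positivity
        obtain ⟨h1, h2⟩ := diffPoly_natDegree_and_leadingCoeff hj.le hl
        exact h _ h2 h1 N hN _ ((Finset.filter_subset _ _).trans (shiftDomain_subset N l))
          (fun x hx => right_ne_zero_of_mul (Finset.mem_filter.mp hx).2)
          (fun x hx => natAbs_eval_diffPoly_le hl hl0
            (shiftDomain_subset N l (Finset.mem_filter.mp hx).1))
    _ = k * 2 ^ j * ((∑ h ∈ Finset.Ioo (-(N : ℤ)) N, w h) ^ j * (C * N * L ^ c)) := by
        rw [← Finset.sum_mul, sum_shiftLists_prod_map]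
    _ ≤ k * 2 ^ j * ((3 * N * L ^ 2 ^ j) ^ j * (C * N * L ^ c)) := by
        have hsum := pow_le_pow_left₀ (Finset.sum_nonneg fun h _ => by positivity)
          (sum_Ioo_card_divisors_pow_le hN j) j
        exact mul_le_mul_of_nonneg_left (mul_le_mul_of_nonneg_right hsum (by positivity))
          (by positivity)
    _ = _ := by rw [mul_pow, mul_pow, ← pow_mul]; ring

lemma eAdd_zero : eAdd 0 = 1 := by simp [eAdd]

lemma eAdd_add (a b : ℝ) : eAdd (a + b) = eAdd a * eAdd b := by
  rw [eAdd, eAdd, eAdd, ← Complex.exp_add]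
  push_cast
  ring_nf

lemma norm_eAdd (a : ℝ) : ‖eAdd a‖ = 1 := by
  rw [eAdd, show 2 * (Real.pi : ℂ) * Complex.I * a = ((2 * Real.pi * a : ℝ) : ℂ) * Complex.I by
    push_cast; ring, Complex.norm_exp_ofReal_mul_I]

lemma conj_eAdd (a : ℝ) : (starRingEnd ℂ) (eAdd a) = eAdd (-a) := by
  rw [eAdd, eAdd, ← Complex.exp_conj]
  simp [Complex.conj_ofNat]

lemma continuous_eAdd : Continuous eAdd := by
  unfold eAdd
  fun_prop

lemma continuous_eAdd_mul (r : ℝ) : Continuous fun α : ℝ => eAdd (α * r) :=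
  continuous_eAdd.comp (continuous_id.mul continuous_const)

lemma integral_eAdd_mul_intCast (m : ℤ) :
    ∫ α in (0 : ℝ)..1, eAdd (α * m) = if m = 0 then 1 else 0 := by
  by_cases hm : m = 0
  · simp [hm, eAdd_zero]
  · rw [if_neg hm]
    have hc : 2 * (Real.pi : ℂ) * Complex.I * m ≠ 0 := by
      simp [Real.pi_ne_zero, hm]
    have h1 : ∀ α : ℝ, eAdd (α * m) = Complex.exp (2 * (Real.pi : ℂ) * Complex.I * m * α) :=
      fun α => by
        rw [eAdd]; push_cast; ring_nf
    simp_rw [h1]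
    rw [integral_exp_mul_complex hc]
    have h2 : Complex.exp (2 * (Real.pi : ℂ) * Complex.I * m * (1 : ℝ)) = 1 := by
      rw [Complex.exp_eq_one_iff]
      exact ⟨m, by push_cast; ring⟩
    rw [h2]
    simp

lemma norm_sq_sum_eAdd {ι : Type*} (s : Finset ι) (φ : ι → ℤ) (α : ℝ) :
    ((‖∑ i ∈ s, eAdd (α * φ i)‖ ^ 2 : ℝ) : ℂ) =
      ∑ i ∈ s, ∑ i' ∈ s, eAdd (α * ((φ i' - φ i : ℤ) : ℝ)) := by
  rw [Complex.ofReal_pow, ← Complex.conj_mul', map_sum, Finset.sum_mul_sum]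
  refine Finset.sum_congr rfl fun i _ => Finset.sum_congr rfl fun i' _ => ?_
  rw [conj_eAdd, ← eAdd_add]
  push_cast
  ring_nf

/-- Parseval's identity for an exponential sum with integer frequencies. -/
lemma integral_norm_sq_sum_eAdd {ι : Type*} (s : Finset ι) (φ : ι → ℤ) :
    ∫ α in (0 : ℝ)..1, ‖∑ i ∈ s, eAdd (α * φ i)‖ ^ 2 =
      ∑ i ∈ s, ((s.filter fun i' => φ i' = φ i).card : ℝ) := by
  have hintble : ∀ m : ℤ, IntervalIntegrable (fun α : ℝ => eAdd (α * m)) MeasureTheory.volume 0 1 :=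
    fun m => (continuous_eAdd_mul _).intervalIntegrable _ _
  apply Complex.ofReal_injective
  rw [← intervalIntegral.integral_ofReal]
  simp_rw [norm_sq_sum_eAdd]
  rw [intervalIntegral.integral_finsetSum fun i _ => Continuous.intervalIntegrable
    (continuous_finsetSum _ fun i' _ => continuous_eAdd_mul _) _ _, Complex.ofReal_sum]
  refine Finset.sum_congr rfl fun i _ => ?_
  rw [intervalIntegral.integral_finsetSum fun i' _ => hintble _]
  simp_rw [integral_eAdd_mul_intCast, sub_eq_zero]
  simp

/-- One step of Weyl differencing. -/
lemma norm_sq_sum_eAdd_eq_sum_shift {N : ℕ} (J : Finset ℤ) (hJ : J ⊆ Finset.Icc 1 (N : ℤ))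
    (φ : ℤ → ℤ) (α : ℝ) :
    ((‖∑ x ∈ J, eAdd (α * φ x)‖ ^ 2 : ℝ) : ℂ) = ∑ h ∈ Finset.Ioo (-(N : ℤ)) N,
      ∑ x ∈ J.filter (fun x => x + h ∈ J), eAdd (α * ((φ (x + h) - φ x : ℤ) : ℝ)) := by
  rw [norm_sq_sum_eAdd]
  simp_rw [Finset.sum_filter]
  rw [Finset.sum_comm (s := Finset.Ioo (-(N : ℤ)) N)]
  refine Finset.sum_congr rfl fun x hx => ?_
  rw [← Finset.sum_filter]
  have hx := Finset.mem_Icc.mp (hJ hx)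
  refine Finset.sum_bij' (fun y _ => y - x) (fun h _ => x + h) ?_ ?_ ?_ ?_ ?_
  · intro y hy
    have hy' := Finset.mem_Icc.mp (hJ hy)
    rw [Finset.mem_filter, Finset.mem_Ioo, add_sub_cancel]
    exact ⟨by omega, hy⟩
  · intro h hh
    exact (Finset.mem_filter.mp hh).2
  · intro y _; ring
  · intro h _; ring
  · intro y _
    rw [add_sub_cancel]

lemma weylSum_eq_sum_diffPhase (k N : ℕ) (α : ℝ) :
    weylSum k N α = ∑ x ∈ Finset.Icc 1 (N : ℤ), eAdd (α * diffPhase k [] x) := by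
  rw [weylSum]
  refine Finset.sum_bij' (fun x _ => (x : ℤ)) (fun x _ => x.toNat) ?_ ?_ ?_ ?_ ?_
  · intro x hx
    rw [Finset.mem_Icc] at hx ⊢; omega
  · intro x hx
    rw [Finset.mem_Icc] at hx ⊢; omega
  · intro x _; simp
  · intro x hx
    rw [Finset.mem_Icc] at hx; omega
  · intro x _
    simp [diffPhase, diffPoly]

/-- Weyl's inequality, before estimating the differenced sum. -/
lemma norm_weylSum_pow_le (k N j : ℕ) (α : ℝ) :
    ‖weylSum k N α‖ ^ 2 ^ j ≤ (2 * N : ℝ) ^ (2 ^ j - j - 1) *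
      ‖∑ e ∈ shiftPairs N j, eAdd (α * diffPhase k e.1 e.2)‖ := by
  simp_rw [shiftPairs, Finset.sum_sigma]
  induction j with
  | zero => simp [shiftLists, shiftDomain, weylSum_eq_sum_diffPhase]
  | succ j ih =>
    set S : List ℤ → ℂ := fun l => ∑ x ∈ shiftDomain N l, eAdd (α * diffPhase k l x) with hS
    have hnext : ∑ l ∈ shiftLists N (j + 1), S l = ((∑ l ∈ shiftLists N j, ‖S l‖ ^ 2 : ℝ) : ℂ) := by
      rw [sum_shiftLists_succ, Complex.ofReal_sum]
      refine Finset.sum_congr rfl fun l _ => ?_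
      rw [hS, norm_sq_sum_eAdd_eq_sum_shift _ (shiftDomain_subset N l)]
      simp only [shiftDomain, diffPhase_cons]
    rw [hnext, Complex.norm_real, Real.norm_of_nonneg (Finset.sum_nonneg fun _ _ => by positivity)]
    have hexp : 2 ^ (j + 1) - (j + 1) - 1 = (2 ^ j - j - 1) * 2 + j := by
      have := Nat.lt_two_pow_self (n := j)
      rw [pow_succ]; omega
    calc ‖weylSum k N α‖ ^ 2 ^ (j + 1) = (‖weylSum k N α‖ ^ 2 ^ j) ^ 2 := by
          rw [pow_succ, pow_mul]
      _ ≤ ((2 * N : ℝ) ^ (2 ^ j - j - 1) * ∑ l ∈ shiftLists N j, ‖S l‖) ^ 2 := by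
          gcongr
          refine ih.trans ?_
          gcongr
          exact norm_sum_le _ _
      _ = ((2 * N : ℝ) ^ (2 ^ j - j - 1)) ^ 2 * (∑ l ∈ shiftLists N j, ‖S l‖) ^ 2 := mul_pow _ _ _
      _ ≤ ((2 * N : ℝ) ^ (2 ^ j - j - 1)) ^ 2 *
          ((2 * N : ℝ) ^ j * ∑ l ∈ shiftLists N j, ‖S l‖ ^ 2) := by
          gcongr
          refine sq_sum_le_card_mul_sum_sq.trans ?_
          gcongr
          exact_mod_cast card_shiftLists_le N j
      _ = _ := by rw [hexp, pow_add, pow_mul]; ring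

/-- Hua's recursive inequality between consecutive moments. -/
lemma integral_norm_weylSum_pow_succ_le {k j : ℕ} (hj : j < k) (N : ℕ) :
    ∫ α in (0 : ℝ)..1, ‖weylSum k N α‖ ^ 2 ^ (j + 1) ≤
      2 * (2 * N : ℝ) ^ (2 ^ j - j - 1) * ((j + k) * (2 * N) ^ j) *
        (∫ α in (0 : ℝ)..1, ‖weylSum k N α‖ ^ 2 ^ j) +
      ((2 * N : ℝ) ^ (2 ^ j - j - 1)) ^ 2 *
        ∑ e ∈ (shiftPairs N j).filter (fun e => diffPhase k e.1 e.2 ≠ 0),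
          (((shiftPairs N j).filter fun e' =>
            diffPhase k e'.1 e'.2 = diffPhase k e.1 e.2).card : ℝ) := by
  set K := (2 * N : ℝ) ^ (2 ^ j - j - 1) with hK
  set Z : ℝ := (j + k) * (2 * N) ^ j with hZ
  have hK0 : 0 ≤ K := by positivity
  set E := (shiftPairs N j).filter fun e => diffPhase k e.1 e.2 ≠ 0 with hE
  set T : ℝ → ℂ := fun α => ∑ e ∈ E, eAdd (α * diffPhase k e.1 e.2) with hT
  have hcont : Continuous fun α => ‖weylSum k N α‖ :=
    (continuous_finsetSum _ fun x _ => by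
      exact_mod_cast continuous_eAdd_mul ((x : ℝ) ^ k)).norm
  have hTcont : Continuous fun α => ‖T α‖ :=
    (continuous_finsetSum _ fun x _ => continuous_eAdd_mul _).norm
  have hpt : ∀ α : ℝ, ‖weylSum k N α‖ ^ 2 ^ (j + 1) ≤
      2 * K * Z * ‖weylSum k N α‖ ^ 2 ^ j + K ^ 2 * ‖T α‖ ^ 2 := fun α => by
    have h1 := norm_weylSum_pow_le k N j α
    have h2 : ‖∑ e ∈ shiftPairs N j, eAdd (α * diffPhase k e.1 e.2)‖ ≤ Z + ‖T α‖ := by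
      rw [← Finset.sum_filter_add_sum_filter_not (shiftPairs N j)
        (fun e => diffPhase k e.1 e.2 = 0)]
      refine (norm_add_le _ _).trans (add_le_add ((norm_sum_le _ _).trans ?_) le_rfl)
      simp_rw [norm_eAdd, Finset.sum_const, nsmul_eq_mul, mul_one]
      rw [hZ]
      exact_mod_cast card_diffPhase_eq_zero_le (N := N) hj
    have h3 : ‖weylSum k N α‖ ^ 2 ^ j ≤ K * (Z + ‖T α‖) := h1.trans (by gcongr)
    have h4 : 0 ≤ ‖weylSum k N α‖ ^ 2 ^ j := by positivity
    rw [pow_succ 2 j, pow_mul]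
    nlinarith [mul_le_mul_of_nonneg_left h3 h4, sq_nonneg (‖weylSum k N α‖ ^ 2 ^ j - K * ‖T α‖)]
  have hTint : ∫ α in (0 : ℝ)..1, ‖T α‖ ^ 2 ≤ ∑ e ∈ E, (((shiftPairs N j).filter fun e' =>
            diffPhase k e'.1 e'.2 = diffPhase k e.1 e.2).card : ℝ) := by
    rw [hT, integral_norm_sq_sum_eAdd]
    gcongr
    exact Finset.filter_subset _ _
  calc _ ≤ ∫ α in (0 : ℝ)..1, (2 * K * Z * ‖weylSum k N α‖ ^ 2 ^ j + K ^ 2 * ‖T α‖ ^ 2) :=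
        intervalIntegral.integral_mono_on zero_le_one
          ((hcont.pow _).intervalIntegrable _ _)
          (((continuous_const.mul (hcont.pow _)).add
            (continuous_const.mul (hTcont.pow _))).intervalIntegrable _ _) fun α _ => hpt α
    _ = 2 * K * Z * (∫ α in (0 : ℝ)..1, ‖weylSum k N α‖ ^ 2 ^ j) +
          K ^ 2 * ∫ α in (0 : ℝ)..1, ‖T α‖ ^ 2 := by
        have h1 : Continuous fun α => 2 * K * Z * ‖weylSum k N α‖ ^ 2 ^ j :=
          continuous_const.mul (hcont.pow _)
        have h2 : Continuous fun α => K ^ 2 * ‖T α‖ ^ 2 := continuous_const.mul (hTcont.pow _)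
        rw [intervalIntegral.integral_add (h1.intervalIntegrable _ _) (h2.intervalIntegrable _ _),
          intervalIntegral.integral_const_mul, intervalIntegral.integral_const_mul]
    _ ≤ _ := by gcongr

lemma exists_integral_norm_weylSum_pow_le {k j : ℕ} (hj : j ≤ k) :
    ∃ C : ℝ, 0 ≤ C ∧ ∃ c : ℕ, ∀ N : ℕ, 1 ≤ N →
      ∫ α in (0 : ℝ)..1, ‖weylSum k N α‖ ^ 2 ^ j ≤
        C * (N : ℝ) ^ (2 ^ j - j) * (1 + Real.log N) ^ c := by
  induction j with
  | zero =>
    refine ⟨1, zero_le_one, 0, fun N hN => ?_⟩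
    have hpt : ∀ α : ℝ, ‖weylSum k N α‖ ≤ N := fun α => by
      refine (norm_sum_le _ _).trans ?_
      simp [norm_eAdd]
    have hcont : Continuous fun α => ‖weylSum k N α‖ :=
      (continuous_finsetSum _ fun x _ => by
        exact_mod_cast continuous_eAdd_mul ((x : ℝ) ^ k)).norm
    have := intervalIntegral.integral_mono_on (μ := MeasureTheory.volume) zero_le_one
      (hcont.intervalIntegrable 0 1) (continuous_const.intervalIntegrable 0 1) fun α _ => hpt α
    simpa using this
  | succ j ih =>
    obtain ⟨C₁, hC₁, c₁, h₁⟩ := ih (by omega)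
    obtain ⟨C₂, hC₂, c₂, h₂⟩ := exists_sum_card_coincidences_le (k := k) (j := j) (by omega)
    set p := 2 ^ j - j - 1 with hp
    have hjp : 2 ^ j = p + j + 1 := by
      have := Nat.lt_two_pow_self (n := j)
      omega
    have hp1 : 2 ^ j - j = p + 1 := by omega
    have hp2 : 2 ^ (j + 1) - (j + 1) = p + j + (p + 1) := by rw [pow_succ]; omega
    refine ⟨2 * 2 ^ p * ((j + k) * 2 ^ j) * C₁ + (2 ^ p) ^ 2 * C₂, by positivity, c₁ + c₂,
      fun N hN => ?_⟩
    set L := 1 + Real.log N with hL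
    have hN1 : (1 : ℝ) ≤ N := by exact_mod_cast hN
    have hL1 : 1 ≤ L := by linarith [Real.log_nonneg hN1]
    refine (integral_norm_weylSum_pow_succ_le (by omega) N).trans ?_
    calc _ ≤ 2 * (2 * N : ℝ) ^ p * ((j + k) * (2 * N) ^ j) *
            (C₁ * (N : ℝ) ^ (2 ^ j - j) * L ^ (c₁ + c₂)) +
          ((2 * N : ℝ) ^ p) ^ 2 * (C₂ * (N : ℝ) ^ (j + 1) * L ^ (c₁ + c₂)) := by
          gcongr
          · exact (h₁ N hN).trans (by gcongr; omega)
          · exact (h₂ N hN).trans (by gcongr; omega)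
      _ = _ := by
          rw [hp1, hp2]
          ring

theorem hua_lemma :
    ∀ k : ℕ, 1 ≤ k → ∃ c : ℝ, 0 ≤ c ∧ ∃ C : ℝ, 0 < C ∧
      ∀ N : ℕ, 2 ≤ N →
        (∫ α in (0:ℝ)..1, ‖weylSum k N α‖ ^ (2 ^ k)) ≤
          C * (N : ℝ) ^ ((2:ℝ) ^ k - (k : ℝ)) * Real.log N ^ c := by
  intro k _
  obtain ⟨C, hC, c, h⟩ := exists_integral_norm_weylSum_pow_le (le_refl k)
  refine ⟨c, Nat.cast_nonneg c, (C + 1) * 3 ^ c, by positivity, fun N hN => ?_⟩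
  have hN2 : (2 : ℝ) ≤ N := by exact_mod_cast hN
  have hlog : 1 / 2 ≤ Real.log N :=
    (by linarith [Real.log_two_gt_d9] : (1 : ℝ) / 2 ≤ Real.log 2).trans
      (Real.log_le_log (by norm_num) hN2)
  have hexp : (N : ℝ) ^ ((2 : ℝ) ^ k - (k : ℝ)) = (N : ℝ) ^ (2 ^ k - k) := by
    rw [← Real.rpow_natCast (N : ℝ), Nat.cast_sub Nat.lt_two_pow_self.le]
    push_cast
    rfl
  rw [hexp, Real.rpow_natCast]
  calc _ ≤ C * (N : ℝ) ^ (2 ^ k - k) * (1 + Real.log N) ^ c := h N (by omega)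
    _ ≤ (C + 1) * (N : ℝ) ^ (2 ^ k - k) * (3 * Real.log N) ^ c := by
        gcongr <;> linarith
    _ = _ := by rw [mul_pow]; ring
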